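/- Let A, X be SPD matrices on ℝⁿ with largest eigenvalue λ of X⁻¹A, and let L be SPD with A ≤ (1/τ)L ≤ λ C_S X in the Loewner order. Let Q_ℓ and B^s be as in the symmetric V-cycle multigrid algorithm with these components over L levels. Then under the approximation properties ‖(Q_ℓ − Q_{ℓ−1})u‖²_{X_ℓ} ≤ C₁λ_ℓ⁻¹‖u‖²_A and ‖Q_ℓ u‖²_A ≤ C₂‖u‖²_A, the error propagation operator satisfies ((I − B^s_L A_L)u, u)_{A_L} ≤ (1 − 1/(C·L))(u,u)_{A_L} with C = (1 + C₂^{1/2} + (C_S C₁)^{1/2})². -/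

import Mathlib

open Matrix

/-- The matrix `B^s_ℓ` of the symmetric multigrid cycle (Bramble's framework):
`B^s₀ = A₀⁻¹` and
`B^s_{ℓ+1} = (I − S^ν (I − P_ℓ B^s_ℓ P_ℓᵀ A_{ℓ+1})^r S^ν) A_{ℓ+1}⁻¹`
with smoothing iteration matrix `S = I − τ_{ℓ+1} L_{ℓ+1}⁻¹ A_{ℓ+1}`. -/
noncomputable def mgB (n : ℕ → ℕ)
    (A Lsm : ∀ ℓ : ℕ, Matrix (Fin (n ℓ)) (Fin (n ℓ)) ℝ)
    (P : ∀ ℓ : ℕ, Matrix (Fin (n (ℓ + 1))) (Fin (n ℓ)) ℝ)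
    (τ : ℕ → ℝ) (ν r : ℕ) : ∀ ℓ : ℕ, Matrix (Fin (n ℓ)) (Fin (n ℓ)) ℝ
  | 0 => (A 0)⁻¹
  | (ℓ + 1) =>
    let S : Matrix (Fin (n (ℓ + 1))) (Fin (n (ℓ + 1))) ℝ :=
      1 - τ (ℓ + 1) • ((Lsm (ℓ + 1))⁻¹ * A (ℓ + 1))
    (1 - S ^ ν * (1 - P ℓ * mgB n A Lsm P τ ν r ℓ * (P ℓ)ᵀ * A (ℓ + 1)) ^ r * S ^ ν) *
      (A (ℓ + 1))⁻¹

namespace Multigrid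

variable {m n k : Type*}

theorem _root_.Matrix.PosSemidef.transpose_eq {M : Matrix m m ℝ} (hM : M.PosSemidef) :
    Mᵀ = M := by
  simpa using hM.isHermitian.eq

variable [Fintype m] [Fintype n] [Fintype k]

theorem mulVec_dotProduct_mulVec (K : Matrix m n ℝ) (M : Matrix m k ℝ) (x : n → ℝ) (y : k → ℝ) :
    (K *ᵥ x) ⬝ᵥ M *ᵥ y = x ⬝ᵥ (Kᵀ * M) *ᵥ y := by
  rw [← mulVec_mulVec, dotProduct_mulVec x, vecMul_transpose]

theorem _root_.Matrix.PosSemidef.transpose_mul_mul_same {M : Matrix m m ℝ} (hM : M.PosSemidef)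
    (K : Matrix m n ℝ) : (Kᵀ * M * K).PosSemidef := by
  simpa using hM.conjTranspose_mul_mul_same K

theorem _root_.Matrix.PosSemidef.form_nonneg {M : Matrix m m ℝ} (hM : M.PosSemidef) (x : m → ℝ) :
    0 ≤ x ⬝ᵥ M *ᵥ x := by
  simpa using hM.dotProduct_mulVec_nonneg x

theorem form_le_form {M N : Matrix m m ℝ} (h : (N - M).PosSemidef) (x : m → ℝ) :
    x ⬝ᵥ M *ᵥ x ≤ x ⬝ᵥ N *ᵥ x := by
  have := h.form_nonneg x
  rwa [sub_mulVec, dotProduct_sub, sub_nonneg] at this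

theorem posSemidef_sub_of_form_le {M N : Matrix m m ℝ} (hM : M.PosSemidef) (hN : N.PosSemidef)
    (h : ∀ x : m → ℝ, x ⬝ᵥ M *ᵥ x ≤ x ⬝ᵥ N *ᵥ x) : (N - M).PosSemidef := by
  refine .of_dotProduct_mulVec_nonneg (hN.isHermitian.sub hM.isHermitian) fun x => ?_
  simpa [sub_mulVec, dotProduct_sub] using h x

/-- The Cauchy–Schwarz inequality for a positive semidefinite matrix. -/
theorem _root_.Matrix.PosSemidef.form_sq_le {M : Matrix m m ℝ} (hM : M.PosSemidef)
    (x y : m → ℝ) : (x ⬝ᵥ M *ᵥ y) ^ 2 ≤ (x ⬝ᵥ M *ᵥ x) * (y ⬝ᵥ M *ᵥ y) := by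
  classical
  have hsymm : LinearMap.IsSymm (toBilin' M) :=
    ⟨fun x y => by
      simp only [toBilin'_apply', RingHom.id_apply]
      rw [dotProduct_mulVec, ← mulVec_transpose, hM.transpose_eq, dotProduct_comm]⟩
  have := (toBilin' M).apply_sq_le_of_symm
    (fun x => by simpa only [toBilin'_apply'] using hM.form_nonneg x) hsymm x y
  simpa only [toBilin'_apply'] using this

/-- `S` is self-adjoint with spectrum in `[0, 1]` for the form of `A`. -/
structure IsUnitInterval (A S : Matrix m m ℝ) : Prop where
  posSemidef : (A * S).PosSemidef
  sub_posSemidef : (A - A * S).PosSemidef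

namespace IsUnitInterval

variable {A S : Matrix m m ℝ}

theorem base (h : IsUnitInterval A S) : A.PosSemidef := by
  simpa using h.posSemidef.add h.sub_posSemidef

theorem transpose_mul (h : IsUnitInterval A S) : Sᵀ * A = A * S := by
  have := h.posSemidef.transpose_eq
  rwa [Matrix.transpose_mul, h.base.transpose_eq] at this

end IsUnitInterval

variable [DecidableEq m] [DecidableEq n]

/-- The bound `(f, q)² ≤ (M⁻¹ f, f) (M q, q)` for a positive definite matrix `M`. -/
theorem _root_.Matrix.PosDef.dotProduct_sq_le {M : Matrix m m ℝ} (hM : M.PosDef)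
    (f q : m → ℝ) : (f ⬝ᵥ q) ^ 2 ≤ (f ⬝ᵥ M⁻¹ *ᵥ f) * (q ⬝ᵥ M *ᵥ q) := by
  have hdet : IsUnit M.det := (isUnit_iff_isUnit_det M).mp hM.isUnit
  have h := hM.posSemidef.form_sq_le (M⁻¹ *ᵥ f) q
  have hinv : (M⁻¹)ᵀ = M⁻¹ := hM.inv.posSemidef.transpose_eq
  rwa [mulVec_dotProduct_mulVec, mulVec_dotProduct_mulVec, hinv, nonsing_inv_mul _ hdet,
    one_mulVec, one_mulVec] at h

namespace IsUnitInterval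

variable {A S : Matrix m m ℝ}

theorem transpose_pow_mul (h : IsUnitInterval A S) (k : ℕ) : (S ^ k)ᵀ * A = A * S ^ k := by
  induction k with
  | zero => simp
  | succ k ih =>
    rw [pow_succ, Matrix.transpose_mul, Matrix.mul_assoc, ih, ← Matrix.mul_assoc, h.transpose_mul,
      Matrix.mul_assoc, ← pow_succ', pow_succ]

theorem compl (h : IsUnitInterval A S) : IsUnitInterval A (1 - S) where
  posSemidef := by simpa [mul_sub] using h.sub_posSemidef
  sub_posSemidef := by simpa [mul_sub] using h.posSemidef

theorem mul_pow_posSemidef (h : IsUnitInterval A S) : ∀ k : ℕ, (A * S ^ k).PosSemidef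
  | 0 => by simpa using h.base
  | 1 => by simpa using h.posSemidef
  | k + 2 => by
    have := (h.mul_pow_posSemidef k).transpose_mul_mul_same S
    rwa [← Matrix.mul_assoc, h.transpose_mul, Matrix.mul_assoc, Matrix.mul_assoc, ← pow_succ,
      ← pow_succ'] at this

theorem mul_pow_sub_posSemidef (h : IsUnitInterval A S) :
    ∀ k : ℕ, (A * S ^ k - A * S ^ (k + 1)).PosSemidef
  | 0 => by simpa using h.sub_posSemidef
  | 1 => by
    have h1 := h.sub_posSemidef.transpose_mul_mul_same S
    have h2 := h.posSemidef.transpose_mul_mul_same (1 - S)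
    rw [← Matrix.mul_assoc, h.compl.transpose_mul] at h2
    rw [Matrix.mul_sub, ← Matrix.mul_assoc, h.transpose_mul] at h1
    convert h1.add h2 using 1
    noncomm_ring
  | k + 2 => by
    have := (h.mul_pow_sub_posSemidef k).transpose_mul_mul_same S
    rw [Matrix.mul_sub, ← Matrix.mul_assoc, ← Matrix.mul_assoc, h.transpose_mul] at this
    convert this using 1
    simp only [pow_succ', Matrix.sub_mul, Matrix.mul_assoc]
    simp only [← pow_succ', ← pow_succ]

theorem mul_pow_antitone (h : IsUnitInterval A S) {j k : ℕ} (hjk : j ≤ k) :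
    (A * S ^ j - A * S ^ k).PosSemidef := by
  induction k, hjk using Nat.le_induction with
  | base => simpa using PosSemidef.zero
  | succ k _ ih => simpa using ih.add (h.mul_pow_sub_posSemidef k)

theorem pow (h : IsUnitInterval A S) (k : ℕ) : IsUnitInterval A (S ^ k) where
  posSemidef := h.mul_pow_posSemidef k
  sub_posSemidef := by simpa using h.mul_pow_antitone k.zero_le

theorem transpose_mul_mul_self (h : IsUnitInterval A S) : Sᵀ * A * S = A * S ^ 2 := by
  rw [h.transpose_mul, Matrix.mul_assoc, sq]

theorem compl_sub_mul_posSemidef (h : IsUnitInterval A S) (k : ℕ) :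
    ((A - A * S) - (A * S ^ k - A * S ^ (k + 1))).PosSemidef := by
  induction k with
  | zero => simpa using PosSemidef.zero
  | succ k ih =>
    have h1 := (h.mul_pow_posSemidef k).transpose_mul_mul_same (1 - S)
    rw [← Matrix.mul_assoc, h.compl.transpose_mul] at h1
    convert ih.add h1 using 1
    have h2 : S * S ^ k = S ^ k * S := (Commute.pow_right rfl k).eq
    simp only [pow_succ, Matrix.mul_sub, Matrix.sub_mul, Matrix.mul_one, Matrix.mul_assoc, h2]
    abel

/-- `‖(1 - Sᵏ) w‖² ≤ ‖w‖² - ‖Sᵏ w‖²` in the norm of `A`. -/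
theorem form_sub_pow_le (h : IsUnitInterval A S) (k : ℕ) (w : m → ℝ) :
    (w - S ^ k *ᵥ w) ⬝ᵥ A *ᵥ (w - S ^ k *ᵥ w) ≤
      w ⬝ᵥ (A - (S ^ k)ᵀ * A * S ^ k) *ᵥ w := by
  have hT := h.pow k
  have e : w - S ^ k *ᵥ w = (1 - S ^ k) *ᵥ w := by rw [sub_mulVec, one_mulVec]
  rw [e, mulVec_mulVec, mulVec_dotProduct_mulVec, ← Matrix.mul_assoc]
  apply form_le_form
  have h1 := hT.mul_pow_sub_posSemidef 1
  rw [hT.transpose_mul_mul_self, hT.compl.transpose_mul_mul_self]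
  convert h1.add h1 using 1
  noncomm_ring

/-- `‖Sᵏ w‖² - (S Sᵏ w, Sᵏ w) ≤ ‖w‖² - ‖Sᵏ w‖²` in the inner product of `A`. -/
theorem form_pow_compl_le (h : IsUnitInterval A S) {k : ℕ} (hk : 1 ≤ k) (w : m → ℝ) :
    (S ^ k *ᵥ w) ⬝ᵥ (A - A * S) *ᵥ (S ^ k *ᵥ w) ≤
      w ⬝ᵥ (A - (S ^ k)ᵀ * A * S ^ k) *ᵥ w := by
  rw [mulVec_mulVec, mulVec_dotProduct_mulVec, ← Matrix.mul_assoc]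
  apply form_le_form
  have h1 := h.compl_sub_mul_posSemidef (2 * k)
  have h2 := h.mul_pow_antitone (show 1 ≤ 2 * k by omega)
  convert h1.add h2 using 1
  rw [(h.pow k).transpose_mul_mul_self, Matrix.mul_sub, ← Matrix.mul_assoc, h.transpose_pow_mul,
    Matrix.sub_mul, Matrix.mul_assoc, Matrix.mul_assoc, Matrix.mul_assoc, ← pow_add, ← pow_succ',
    ← pow_add, ← pow_mul, mul_comm k 2, pow_one, show k + (k + 1) = 2 * k + 1 by omega, ← two_mul]
  abel

end IsUnitInterval

/-- One smoothing step with an SPD matrix `M ≥ A` is an `A`-contraction with spectrum in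
`[0, 1]`. -/
theorem isUnitInterval_one_sub_inv_mul {A M : Matrix m m ℝ} (hA : A.PosSemidef) (hM : M.PosDef)
    (hAM : (M - A).PosSemidef) : IsUnitInterval A (1 - M⁻¹ * A) := by
  have hdet : IsUnit M.det := (isUnit_iff_isUnit_det M).mp hM.isUnit
  have hMK : M * (M⁻¹ * A) = A := mul_nonsing_inv_cancel_left _ _ hdet
  have hKM : (M⁻¹ * A)ᵀ * M = A := by
    rw [Matrix.transpose_mul, hA.transpose_eq, hM.inv.posSemidef.transpose_eq, Matrix.mul_assoc,
      nonsing_inv_mul _ hdet, Matrix.mul_one]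
  generalize M⁻¹ * A = K at hMK hKM
  have hKA : Kᵀ * A = A * K := by rw [← hMK, ← Matrix.mul_assoc, hKM, hMK]
  refine ⟨?_, ?_⟩
  · have h1 := hA.transpose_mul_mul_same (1 - K)
    have h2 := hAM.transpose_mul_mul_same K
    convert h1.add h2 using 1
    simp only [transpose_sub, transpose_one, Matrix.sub_mul, Matrix.mul_sub, hKM, hKA,
      Matrix.mul_one, Matrix.one_mul]
    abel
  · have := hM.posSemidef.transpose_mul_mul_same K
    rw [hKM] at this
    simpa [Matrix.mul_sub] using this

namespace IsUnitInterval

variable {A S T G : Matrix m m ℝ}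

theorem conj (hT : IsUnitInterval A T) (hG : IsUnitInterval A G) :
    IsUnitInterval A (T * G * T) := by
  have e : A * (T * G * T) = Tᵀ * (A * G) * T := by
    rw [← Matrix.mul_assoc Tᵀ, hT.transpose_mul]
    simp only [Matrix.mul_assoc]
  refine ⟨e ▸ hG.posSemidef.transpose_mul_mul_same T, ?_⟩
  have h1 := hT.mul_pow_antitone (Nat.zero_le 2)
  have h2 := hG.sub_posSemidef.transpose_mul_mul_same T
  convert h1.add h2 using 1
  rw [← hT.transpose_mul_mul_self, e]
  simp only [pow_zero, Matrix.mul_sub, Matrix.sub_mul, Matrix.mul_one]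
  abel

theorem mul_inv_posSemidef (hA : A.PosDef) (h : IsUnitInterval A S) :
    (S * A⁻¹).PosSemidef := by
  have hdet : IsUnit A.det := (isUnit_iff_isUnit_det A).mp hA.isUnit
  have := h.posSemidef.transpose_mul_mul_same A⁻¹
  rwa [hA.inv.posSemidef.transpose_eq, nonsing_inv_mul_cancel_left _ _ hdet] at this

/-- Coarse-grid correction with an approximate coarse inverse `0 ≤ B ≤ (PᵀAP)⁻¹`. -/
theorem coarse_correction {P : Matrix m n ℝ} {B : Matrix n n ℝ}
    (hA : A.PosSemidef) (hAc : (Pᵀ * A * P).PosDef) (hB : B.PosSemidef)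
    (hB' : ((Pᵀ * A * P)⁻¹ - B).PosSemidef) :
    IsUnitInterval A (1 - P * B * Pᵀ * A) := by
  have hdet : IsUnit (Pᵀ * A * P).det := (isUnit_iff_isUnit_det _).mp hAc.isUnit
  have hinv : (Pᵀ * A * P)⁻¹ * (Pᵀ * A * P) = 1 := nonsing_inv_mul _ hdet
  have hCt := hAc.inv.posSemidef.transpose_eq
  generalize (Pᵀ * A * P)⁻¹ = C at hB' hinv hCt
  have e : (Pᵀ * A)ᵀ = A * P := by rw [Matrix.transpose_mul, hA.transpose_eq, transpose_transpose]
  constructor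
  · have h1 := hA.transpose_mul_mul_same (1 - P * C * Pᵀ * A)
    have h2 := hB'.transpose_mul_mul_same (Pᵀ * A)
    have e1 : (P * C * Pᵀ * A)ᵀ = A * P * C * Pᵀ := by
      simp only [Matrix.transpose_mul, hA.transpose_eq, hCt, transpose_transpose,
        Matrix.mul_assoc]
    have e2 : A * P * C * Pᵀ * A * (P * C * Pᵀ * A) = A * P * C * Pᵀ * A := by
      calc _ = A * P * (C * (Pᵀ * A * P)) * (C * Pᵀ * A) := by simp only [Matrix.mul_assoc]
        _ = _ := by rw [hinv]; simp only [Matrix.mul_assoc, Matrix.one_mul]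
    convert h1.add h2 using 1
    simp only [transpose_sub, transpose_one, e, e1, Matrix.sub_mul, Matrix.mul_sub, e2,
      Matrix.mul_one, Matrix.one_mul]
    simp only [Matrix.mul_assoc]
    abel
  · have := hB.transpose_mul_mul_same (Pᵀ * A)
    rw [e] at this
    convert this using 1
    simp only [Matrix.mul_sub, Matrix.mul_one, Matrix.mul_assoc]
    abel

end IsUnitInterval

/-- The multigrid approximate inverse with smoothing iteration matrix `S`, built on the coarse
approximate inverse `B`. -/
noncomputable def cycleMatrix (A S : Matrix m m ℝ) (P : Matrix m n ℝ) (B : Matrix n n ℝ)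
    (ν r : ℕ) : Matrix m m ℝ :=
  (1 - S ^ ν * (1 - P * B * Pᵀ * A) ^ r * S ^ ν) * A⁻¹

section Cycle

variable {A S : Matrix m m ℝ} {P : Matrix m n ℝ} {B : Matrix n n ℝ}

theorem cycleMatrix_posSemidef (hA : A.PosDef) (hAc : (Pᵀ * A * P).PosDef)
    (hS : IsUnitInterval A S) (hB : B.PosSemidef) (hB' : ((Pᵀ * A * P)⁻¹ - B).PosSemidef)
    (ν r : ℕ) :
    (cycleMatrix A S P B ν r).PosSemidef ∧ (A⁻¹ - cycleMatrix A S P B ν r).PosSemidef := by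
  have hE := (hS.pow ν).conj
    ((IsUnitInterval.coarse_correction hA.posSemidef hAc hB hB').pow r)
  refine ⟨hE.compl.mul_inv_posSemidef hA, ?_⟩
  simpa [cycleMatrix, Matrix.sub_mul] using hE.mul_inv_posSemidef hA

/-- Energy removed by a cycle: the smoothing loss plus what the coarse cycle removes. -/
theorem le_cycleMatrix_form (hA : A.PosDef) (hAc : (Pᵀ * A * P).PosDef)
    (hS : IsUnitInterval A S) (hB : B.PosSemidef) (hB' : ((Pᵀ * A * P)⁻¹ - B).PosSemidef)
    (ν : ℕ) {r : ℕ} (hr : 1 ≤ r) (w : m → ℝ) :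
    w ⬝ᵥ (A - (S ^ ν)ᵀ * A * S ^ ν) *ᵥ w +
        (Pᵀ *ᵥ A *ᵥ S ^ ν *ᵥ w) ⬝ᵥ B *ᵥ Pᵀ *ᵥ A *ᵥ S ^ ν *ᵥ w ≤
      (A *ᵥ w) ⬝ᵥ cycleMatrix A S P B ν r *ᵥ A *ᵥ w := by
  have hdet : IsUnit A.det := (isUnit_iff_isUnit_det A).mp hA.isUnit
  have hG := IsUnitInterval.coarse_correction hA.posSemidef hAc hB hB'
  have hT := hS.pow ν
  have h := (hG.mul_pow_antitone hr).transpose_mul_mul_same (S ^ ν)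
  have e : (A *ᵥ w) ⬝ᵥ cycleMatrix A S P B ν r *ᵥ A *ᵥ w =
      w ⬝ᵥ (A - (S ^ ν)ᵀ * (A * (1 - P * B * Pᵀ * A) ^ r) * S ^ ν) *ᵥ w := by
    rw [cycleMatrix, mulVec_mulVec, Matrix.mul_assoc, nonsing_inv_mul _ hdet, Matrix.mul_one,
      mulVec_dotProduct_mulVec, hA.posSemidef.transpose_eq, ← Matrix.mul_assoc (S ^ ν)ᵀ,
      hT.transpose_mul, Matrix.mul_sub, Matrix.mul_one]
    simp only [Matrix.mul_assoc]
  have e' : (Pᵀ *ᵥ A *ᵥ S ^ ν *ᵥ w) ⬝ᵥ B *ᵥ Pᵀ *ᵥ A *ᵥ S ^ ν *ᵥ w =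
      w ⬝ᵥ ((S ^ ν)ᵀ * (A * P * B * Pᵀ * A) * S ^ ν) *ᵥ w := by
    simp only [mulVec_mulVec]
    rw [mulVec_dotProduct_mulVec]
    simp only [Matrix.transpose_mul, hA.posSemidef.transpose_eq, transpose_transpose,
      Matrix.mul_assoc]
  rw [e, e', ← dotProduct_add, ← add_mulVec]
  apply form_le_form
  convert h using 1
  simp only [pow_one, Matrix.mul_sub, Matrix.sub_mul, Matrix.mul_one, Matrix.mul_assoc]
  abel

end Cycle

theorem sq_add_le_of_sq_le {x y z κ a c U b δ : ℝ} (ha : 0 ≤ a) (hc : 0 ≤ c) (hκ : 0 ≤ κ)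
    (hU : 0 ≤ U) (hb : 0 ≤ b) (hδ : 0 ≤ δ) (hx : x ^ 2 ≤ κ * U * b) (hy : y ^ 2 ≤ a * U * δ)
    (hz : z ^ 2 ≤ c ^ 2 * U * δ) :
    (x + y + z) ^ 2 ≤ (κ + (√a + c) ^ 2) * U * (δ + b) := by
  have hs := Real.sq_sqrt ha
  have hyz : (y + z) ^ 2 ≤ (√a + c) ^ 2 * U * δ := by
    have h1 : |y * z| ≤ √a * c * (U * δ) := by
      refine abs_le_of_sq_le_sq ?_ (by positivity)
      calc (y * z) ^ 2 = y ^ 2 * z ^ 2 := by ring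
        _ ≤ (a * U * δ) * (c ^ 2 * U * δ) := by gcongr
        _ = (√a * c * (U * δ)) ^ 2 := by linear_combination -(c ^ 2 * (U * δ) ^ 2) * hs
    have h2 : (√a + c) ^ 2 * U * δ =
        a * U * δ + c ^ 2 * U * δ + 2 * (√a * c * (U * δ)) := by
      linear_combination U * δ * hs
    rw [h2]
    linarith [le_abs_self (y * z), add_sq y z]
  set k := (√a + c) ^ 2
  have hk : 0 ≤ k := sq_nonneg _
  have h2 : 2 * (x * (y + z)) ≤ κ * U * δ + k * U * b := by
    refine le_of_sq_le_sq ?_ (by positivity)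
    calc (2 * (x * (y + z))) ^ 2 = 4 * (x ^ 2 * (y + z) ^ 2) := by ring
      _ ≤ 4 * ((κ * U * b) * (k * U * δ)) := by gcongr
      _ ≤ _ := by nlinarith [sq_nonneg (κ * U * δ - k * U * b)]
  nlinarith

/-- Propagation of the bound `(f, p)² ≤ κ U (B f, f)` through one multigrid cycle, where `q` is
the fine-level approximation with coarse part `p`. -/
theorem sq_dotProduct_le_cycleMatrix {A M : Matrix m m ℝ} {P : Matrix m n ℝ} {B : Matrix n n ℝ}
    (hA : A.PosDef) (hM : M.PosDef) (hAM : (M - A).PosSemidef) (hAc : (Pᵀ * A * P).PosDef)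
    (hB : B.PosSemidef) (hB' : ((Pᵀ * A * P)⁻¹ - B).PosSemidef) {ν r : ℕ} (hν : 1 ≤ ν)
    (hr : 1 ≤ r) {κ a c U : ℝ} (hκ : 0 ≤ κ) (ha : 0 ≤ a) (hc : 0 ≤ c) (hU : 0 ≤ U)
    {q : m → ℝ} {p : n → ℝ} (hd : (q - P *ᵥ p) ⬝ᵥ M *ᵥ (q - P *ᵥ p) ≤ a * U)
    (hq : q ⬝ᵥ A *ᵥ q ≤ c ^ 2 * U) (hp : ∀ g : n → ℝ, (g ⬝ᵥ p) ^ 2 ≤ κ * U * (g ⬝ᵥ B *ᵥ g))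
    (f : m → ℝ) :
    (f ⬝ᵥ q) ^ 2 ≤
      (κ + (√a + c) ^ 2) * U * (f ⬝ᵥ cycleMatrix A (1 - M⁻¹ * A) P B ν r *ᵥ f) := by
  have hdet : IsUnit A.det := (isUnit_iff_isUnit_det A).mp hA.isUnit
  have hS := isUnitInterval_one_sub_inv_mul hA.posSemidef hM hAM
  obtain ⟨w, rfl⟩ : ∃ w, A *ᵥ w = f :=
    ⟨A⁻¹ *ᵥ f, by rw [mulVec_mulVec, mul_nonsing_inv _ hdet, one_mulVec]⟩
  have henergy := le_cycleMatrix_form hA hAc hS hB hB' ν hr w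
  have hdiff := hS.form_sub_pow_le ν w
  have hcompl := hS.form_pow_compl_le hν w
  set S := 1 - M⁻¹ * A with hSdef
  set v := S ^ ν *ᵥ w
  set δ := w ⬝ᵥ (A - (S ^ ν)ᵀ * A * S ^ ν) *ᵥ w
  set g := Pᵀ *ᵥ A *ᵥ v
  have hδ : 0 ≤ δ := (hA.posSemidef.form_nonneg _).trans hdiff
  have hsmooth : ∀ x, (A *ᵥ x) ⬝ᵥ M⁻¹ *ᵥ A *ᵥ x = x ⬝ᵥ (A - A * S) *ᵥ x := fun x => by
    rw [mulVec_mulVec, mulVec_dotProduct_mulVec, hA.posSemidef.transpose_eq, hSdef]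
    congr 2
    noncomm_ring
  have hx := hp g
  have hy : ((A *ᵥ v) ⬝ᵥ (q - P *ᵥ p)) ^ 2 ≤ a * U * δ := by
    refine (hM.dotProduct_sq_le _ _).trans ?_
    rw [hsmooth, mul_comm (a * U)]
    exact mul_le_mul hcompl hd (hM.posSemidef.form_nonneg _) hδ
  have hz : ((w - v) ⬝ᵥ A *ᵥ q) ^ 2 ≤ c ^ 2 * U * δ := by
    refine (hA.posSemidef.form_sq_le _ _).trans ?_
    rw [mul_comm (c ^ 2 * U)]
    exact mul_le_mul hdiff hq (hA.posSemidef.form_nonneg _) hδ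
  have hsplit : (A *ᵥ w) ⬝ᵥ q =
      g ⬝ᵥ p + (A *ᵥ v) ⬝ᵥ (q - P *ᵥ p) + (w - v) ⬝ᵥ A *ᵥ q := by
    have e1 : g ⬝ᵥ p = (A *ᵥ v) ⬝ᵥ P *ᵥ p := by
      rw [dotProduct_mulVec, ← mulVec_transpose]
    have e2 : ∀ x : m → ℝ, x ⬝ᵥ A *ᵥ q = (A *ᵥ x) ⬝ᵥ q := fun x => by
      rw [dotProduct_mulVec, ← mulVec_transpose, hA.posSemidef.transpose_eq]
    rw [e1, e2, dotProduct_sub, mulVec_sub, sub_dotProduct]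
    ring
  rw [hsplit]
  exact (sq_add_le_of_sq_le ha hc hκ hU (hB.form_nonneg g) hδ hx hy hz).trans (by gcongr)

theorem nonneg_of_inv_mul_mulVec_eq_smul {A X : Matrix m m ℝ} (hA : A.PosSemidef) (hX : X.PosDef)
    {μ : ℝ} {v : m → ℝ} (hv : v ≠ 0) (h : (X⁻¹ * A) *ᵥ v = μ • v) : 0 ≤ μ := by
  have hdet : IsUnit X.det := (isUnit_iff_isUnit_det X).mp hX.isUnit
  have h1 : A *ᵥ v = μ • X *ᵥ v := by
    rw [← mulVec_smul, ← h, mulVec_mulVec, mul_nonsing_inv_cancel_left _ _ hdet]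
  have h2 := hA.form_nonneg v
  rw [h1, dotProduct_smul, smul_eq_mul] at h2
  have h3 : 0 < v ⬝ᵥ X *ᵥ v := by simpa using hX.dotProduct_mulVec_pos hv
  exact nonneg_of_mul_nonneg_left h2 h3

end Multigrid

/-- Bramble's no-regularity multigrid convergence theorem:
with Galerkin matrices `A ℓ`, SPD matrices `X ℓ`, SPD smoothers `Lsm ℓ`,
`λ ℓ` the largest eigenvalue of `(X ℓ)⁻¹ A ℓ`, the Loewner smoother condition
`A_ℓ ≤ (1/τ_ℓ)L_ℓ ≤ λ_ℓ C_S X_ℓ`, operators `Q ℓ : V_L → V_ℓ` with `Q L = I`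
satisfying the approximation properties
`‖(Q_{ℓ+1} − Q_ℓ)u‖²_{X_{ℓ+1}} ≤ C₁ λ_{ℓ+1}⁻¹ ‖u‖²_A` and `‖Q_ℓ u‖²_A ≤ C₂ ‖u‖²_A`,
the V-cycle/W-cycle error propagation satisfies
`((I − B^s_L A_L)u, u)_{A_L} ≤ (1 − 1/(C·L)) (u, u)_{A_L}`
with `C = (1 + √C₂ + √(C_S C₁))²`. -/
theorem stmt17 (L : ℕ) (hL : 1 ≤ L) (n : ℕ → ℕ)
    (A X Lsm : ∀ ℓ : ℕ, Matrix (Fin (n ℓ)) (Fin (n ℓ)) ℝ)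
    (P : ∀ ℓ : ℕ, Matrix (Fin (n (ℓ + 1))) (Fin (n ℓ)) ℝ)
    (Q : ∀ ℓ : ℕ, Matrix (Fin (n ℓ)) (Fin (n L)) ℝ)
    (τ lam : ℕ → ℝ) (ν r : ℕ) (hν : 1 ≤ ν) (hr : 1 ≤ r)
    (C₁ C₂ Cs : ℝ) (hC₁ : 0 < C₁) (hC₂ : 0 < C₂) (hCs : 0 < Cs)
    (hτ : ∀ ℓ, 0 < τ ℓ)
    (hApos : ∀ ℓ, (A ℓ).PosDef) (hXpos : ∀ ℓ, (X ℓ).PosDef)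
    (hLpos : ∀ ℓ, (Lsm ℓ).PosDef)
    -- the Galerkin relation between consecutive levels
    (hGal : ∀ ℓ, A ℓ = (P ℓ)ᵀ * A (ℓ + 1) * P ℓ)
    -- λ ℓ is the largest eigenvalue of (X ℓ)⁻¹ A ℓ
    (hlam : ∀ ℓ, IsGreatest
      {μ : ℝ | ∃ v : Fin (n ℓ) → ℝ, v ≠ 0 ∧ ((X ℓ)⁻¹ * A ℓ) *ᵥ v = μ • v} (lam ℓ))
    -- smoother property: A ≤ (1/τ)L ≤ λ C_S X in the Loewner order
    (hSmo : ∀ ℓ, 1 ≤ ℓ → ℓ ≤ L → ∀ x : Fin (n ℓ) → ℝ,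
      x ⬝ᵥ A ℓ *ᵥ x ≤ (1 / τ ℓ) * (x ⬝ᵥ Lsm ℓ *ᵥ x) ∧
      (1 / τ ℓ) * (x ⬝ᵥ Lsm ℓ *ᵥ x) ≤ lam ℓ * Cs * (x ⬝ᵥ X ℓ *ᵥ x))
    -- Q L is the identity
    (hQL : Q L = 1)
    -- approximation property (telescoping differences, measured in X-norms)
    (hApprox1 : ∀ ℓ, ℓ + 1 ≤ L → ∀ u : Fin (n L) → ℝ,
      (Q (ℓ + 1) *ᵥ u - P ℓ *ᵥ (Q ℓ *ᵥ u)) ⬝ᵥ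
          X (ℓ + 1) *ᵥ (Q (ℓ + 1) *ᵥ u - P ℓ *ᵥ (Q ℓ *ᵥ u)) ≤
        C₁ / lam (ℓ + 1) * (u ⬝ᵥ A L *ᵥ u))
    -- stability of the Q ℓ in the A-norm
    (hApprox2 : ∀ ℓ, ℓ ≤ L → ∀ u : Fin (n L) → ℝ,
      (Q ℓ *ᵥ u) ⬝ᵥ A ℓ *ᵥ (Q ℓ *ᵥ u) ≤ C₂ * (u ⬝ᵥ A L *ᵥ u)) :
    ∀ u : Fin (n L) → ℝ,
      u ⬝ᵥ A L *ᵥ ((1 - mgB n A Lsm P τ ν r L * A L) *ᵥ u) ≤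
        (1 - 1 / ((1 + Real.sqrt C₂ + Real.sqrt (Cs * C₁)) ^ 2 * L)) *
          (u ⬝ᵥ A L *ᵥ u) := by
  intro u
  have hdet : ∀ ℓ, IsUnit (A ℓ).det := fun ℓ => (isUnit_iff_isUnit_det _).mp (hApos ℓ).isUnit
  set U := u ⬝ᵥ A L *ᵥ u with hUdef
  have hU : 0 ≤ U := (hApos L).posSemidef.form_nonneg u
  have ha : 0 ≤ Cs * C₁ := by positivity
  set M : ∀ ℓ, Matrix (Fin (n ℓ)) (Fin (n ℓ)) ℝ := fun ℓ => (1 / τ ℓ) • Lsm ℓ with hMdef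
  have hMform : ∀ ℓ (x : Fin (n ℓ) → ℝ), x ⬝ᵥ M ℓ *ᵥ x = 1 / τ ℓ * (x ⬝ᵥ Lsm ℓ *ᵥ x) :=
    fun ℓ x => by rw [hMdef, smul_mulVec, dotProduct_smul, smul_eq_mul]
  have hMpos : ∀ ℓ, (M ℓ).PosDef := fun ℓ => (hLpos ℓ).smul (one_div_pos.mpr (hτ ℓ))
  have hAM : ∀ ℓ, 1 ≤ ℓ → ℓ ≤ L → (M ℓ - A ℓ).PosSemidef := fun ℓ h1 h2 =>
    Multigrid.posSemidef_sub_of_form_le (hApos ℓ).posSemidef (hMpos ℓ).posSemidef fun x => by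
      rw [hMform]; exact (hSmo ℓ h1 h2 x).1
  have hMinv : ∀ ℓ, (M ℓ)⁻¹ * A ℓ = τ ℓ • ((Lsm ℓ)⁻¹ * A ℓ) := fun ℓ => by
    have h : (M ℓ)⁻¹ = τ ℓ • (Lsm ℓ)⁻¹ := by
      refine inv_eq_left_inv ?_
      rw [hMdef, smul_mul_smul_comm, mul_one_div_cancel (hτ ℓ).ne', one_smul,
        nonsing_inv_mul _ ((isUnit_iff_isUnit_det _).mp (hLpos ℓ).isUnit)]
    rw [h, smul_mul]
  have hstep : ∀ ℓ, mgB n A Lsm P τ ν r (ℓ + 1) = Multigrid.cycleMatrix (A (ℓ + 1))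
      (1 - (M (ℓ + 1))⁻¹ * A (ℓ + 1)) (P ℓ) (mgB n A Lsm P τ ν r ℓ) ν r := fun ℓ => by
    rw [hMinv]; rfl
  have hlam0 : ∀ ℓ, 0 ≤ lam ℓ := fun ℓ => by
    obtain ⟨v, hv, h⟩ := (hlam ℓ).1
    exact Multigrid.nonneg_of_inv_mul_mulVec_eq_smul (hApos ℓ).posSemidef (hXpos ℓ) hv h
  have hAc : ∀ ℓ, ((P ℓ)ᵀ * A (ℓ + 1) * P ℓ).PosDef := fun ℓ => hGal ℓ ▸ hApos ℓ
  have hB : ∀ ℓ, ℓ ≤ L → (mgB n A Lsm P τ ν r ℓ).PosSemidef ∧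
      ((A ℓ)⁻¹ - mgB n A Lsm P τ ν r ℓ).PosSemidef := by
    intro ℓ
    induction ℓ with
    | zero =>
      intro _
      refine ⟨(hApos 0).inv.posSemidef, ?_⟩
      simpa [mgB] using PosSemidef.zero
    | succ ℓ ih =>
      intro hℓ
      obtain ⟨h1, h2⟩ := ih (by omega)
      rw [hstep]
      exact Multigrid.cycleMatrix_posSemidef (hApos _) (hAc ℓ)
        (Multigrid.isUnitInterval_one_sub_inv_mul (hApos _).posSemidef (hMpos _)
          (hAM _ (by omega) hℓ)) h1 (hGal ℓ ▸ h2) ν r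
  have hcycle : ∀ ℓ, ℓ + 1 ≤ L → ∀ κ c : ℝ, 0 ≤ κ → 0 ≤ c →
      (Q (ℓ + 1) *ᵥ u) ⬝ᵥ A (ℓ + 1) *ᵥ (Q (ℓ + 1) *ᵥ u) ≤ c ^ 2 * U →
      (∀ g, (g ⬝ᵥ Q ℓ *ᵥ u) ^ 2 ≤ κ * U * (g ⬝ᵥ mgB n A Lsm P τ ν r ℓ *ᵥ g)) →
      ∀ f, (f ⬝ᵥ Q (ℓ + 1) *ᵥ u) ^ 2 ≤
        (κ + (√(Cs * C₁) + c) ^ 2) * U * (f ⬝ᵥ mgB n A Lsm P τ ν r (ℓ + 1) *ᵥ f) := by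
    intro ℓ hℓ κ c hκ hc hq hp
    obtain ⟨h1, h2⟩ := hB ℓ (by omega)
    rw [hstep]
    refine Multigrid.sq_dotProduct_le_cycleMatrix (hApos _) (hMpos _) (hAM _ (by omega) hℓ)
      (hAc ℓ) h1 (hGal ℓ ▸ h2) hν hr hκ ha hc hU ?_ hq hp
    rw [hMform]
    refine (hSmo _ (by omega) hℓ _).2.trans ?_
    have hl := hlam0 (ℓ + 1)
    refine (mul_le_mul_of_nonneg_left (hApprox1 ℓ hℓ u) (by positivity)).trans ?_
    rcases hl.eq_or_lt with h0 | h0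
    · rw [← h0]
      simpa using mul_nonneg ha hU
    · refine le_of_eq ?_
      field_simp
      rfl
  have hκ : ∀ ℓ, ℓ ≤ L → ∀ f, (f ⬝ᵥ Q ℓ *ᵥ u) ^ 2 ≤
      (C₂ + ℓ * (√(Cs * C₁) + √C₂) ^ 2) * U * (f ⬝ᵥ mgB n A Lsm P τ ν r ℓ *ᵥ f) := by
    intro ℓ
    induction ℓ with
    | zero =>
      intro h0 f
      refine ((hApos 0).dotProduct_sq_le f _).trans ?_
      rw [mul_comm]
      have hf := (hApos 0).inv.posSemidef.form_nonneg f
      have := mul_le_mul_of_nonneg_right (hApprox2 0 h0 u) hf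
      simpa [mgB] using this
    | succ ℓ ih =>
      intro hℓ f
      refine (hcycle ℓ hℓ _ (√C₂) (by positivity) (by positivity) ?_ (ih (by omega)) f).trans
        (le_of_eq ?_)
      · rw [Real.sq_sqrt hC₂.le]
        exact hApprox2 _ hℓ u
      · push_cast
        ring
  obtain ⟨k, rfl⟩ := Nat.exists_eq_add_of_le' hL
  set β := (A (k + 1) *ᵥ u) ⬝ᵥ mgB n A Lsm P τ ν r (k + 1) *ᵥ A (k + 1) *ᵥ u with hβdef
  have hβ : 0 ≤ β := (hB (k + 1) le_rfl).1.form_nonneg _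
  have hmain : U ^ 2 ≤ (C₂ + k * (√(Cs * C₁) + √C₂) ^ 2 + (√(Cs * C₁) + 1) ^ 2) * U * β := by
    have := hcycle k le_rfl _ 1 (by positivity) zero_le_one ?_ (hκ k (by omega))
      (A (k + 1) *ᵥ u)
    · rwa [hQL, one_mulVec, dotProduct_comm] at this
    · rw [hQL, one_mulVec, one_pow, one_mul]
  have hsplit : u ⬝ᵥ A (k + 1) *ᵥ ((1 - mgB n A Lsm P τ ν r (k + 1) * A (k + 1)) *ᵥ u) =
      U - β := by
    rw [sub_mulVec, one_mulVec, mulVec_sub, dotProduct_sub, hβdef,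
      Multigrid.mulVec_dotProduct_mulVec, (hApos _).posSemidef.transpose_eq]
    simp only [mulVec_mulVec, Matrix.mul_assoc, hUdef]
  rw [hsplit]
  have hs := Real.sq_sqrt hC₂.le
  have hs0 := Real.sqrt_nonneg C₂
  have ha0 := Real.sqrt_nonneg (Cs * C₁)
  set s := √C₂
  set a := √(Cs * C₁)
  have hconst : C₂ + k * (a + s) ^ 2 + (a + 1) ^ 2 ≤ (1 + s + a) ^ 2 * (k + 1 : ℕ) := by
    push_cast
    have h1 : (a + s) ^ 2 ≤ (1 + s + a) ^ 2 := by gcongr ?_ ^ 2; linarith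
    have h2 := mul_le_mul_of_nonneg_left h1 (Nat.cast_nonneg (α := ℝ) k)
    nlinarith [mul_nonneg hs0 ha0]
  set K := (1 + s + a) ^ 2 * ((k + 1 : ℕ) : ℝ)
  have hK : 0 < K := by positivity
  have hUβ : U ≤ K * β := by
    rcases hU.eq_or_lt with h0 | h0
    · rw [← h0]; positivity
    · have : U * U ≤ U * (K * β) := by
        calc U * U = U ^ 2 := by ring
          _ ≤ _ := hmain
          _ ≤ K * U * β := by gcongr
          _ = _ := by ring
      exact le_of_mul_le_mul_left this h0
  have : U / K ≤ β := (div_le_iff₀' hK).mpr hUβ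
  rw [sub_mul, one_mul, one_div_mul_eq_div]
  linarith
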